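/- arXiv:2403.14081 — 7 statements merged into one kernel-verified Lean document; each statement's English description precedes it below -/
import Mathlib

section
/- The explicit 4×4 matrices U and C satisfy: U⁴ = I, C² = I, det U = 1, det C = 1, and, setting a = U²·C and b = (a·U·a)⁻¹·U, the two relator identities a·a·b·b·a⁻¹·b⁻¹·a⁻¹·b·b = I and a·b⁻¹·a·b⁻¹·a·b·a·a·a·b = I hold. (Hence (U, C) defines a representation ρ_t of the orbifold group vol3/⟨u⟩ = ⟨u, c⟩, and via a = u²c, b = (aua)⁻¹u, of the manifold group vol3 = ⟨a, b | aabbABAbb, aBaBabaaab⟩, into SL(4, ℝ).) -/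
open Matrix

/-- The matrix `U`, written in terms of `k = s / r`. -/
def uMat (k : ℝ) : Matrix (Fin 4) (Fin 4) ℝ :=
  !![1, 0, 0, 0; 0, 1, 0, 0; 0, 0, k, 1; 0, 0, -(1 + k ^ 2), -k]

/-- The square of `uMat k`. -/
def dMat : Matrix (Fin 4) (Fin 4) ℝ :=
  !![1, 0, 0, 0; 0, 1, 0, 0; 0, 0, -1, 0; 0, 0, 0, -1]

/-- The inverse of `uMat k`. -/
def vMat (k : ℝ) : Matrix (Fin 4) (Fin 4) ℝ :=
  !![1, 0, 0, 0; 0, 1, 0, 0; 0, 0, -k, -1; 0, 0, 1 + k ^ 2, k]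

/-- The matrix `C`, written in terms of `p = (t + r) / 2` and `q = (r - t) / 2`. -/
def cMat (p q : ℝ) : Matrix (Fin 4) (Fin 4) ℝ :=
  !![p, 0, 1 - p ^ 2, 0; 0, -q, 0, q ^ 2 - 1; 1, 0, -p, 0; 0, -1, 0, q]

theorem cMat_mul_self (p q : ℝ) : cMat p q * cMat p q = 1 := by
  ext i j
  fin_cases i <;> fin_cases j <;> simp [cMat, Matrix.mul_apply, Fin.sum_univ_four] <;> ring

theorem uMat_mul_self (k : ℝ) : uMat k * uMat k = dMat := by
  ext i j
  fin_cases i <;> fin_cases j <;>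
    simp [uMat, dMat, Matrix.mul_apply, Fin.sum_univ_four] <;> ring

theorem uMat_mul_dMat (k : ℝ) : uMat k * dMat = vMat k := by
  ext i j
  fin_cases i <;> fin_cases j <;>
    simp [uMat, dMat, vMat, Matrix.mul_apply, Fin.sum_univ_four]

theorem dMat_mul_self : dMat * dMat = 1 := by
  ext i j
  fin_cases i <;> fin_cases j <;> simp [dMat, Matrix.mul_apply, Fin.sum_univ_four]

theorem det_uMat (k : ℝ) : (uMat k).det = 1 := by
  simp [uMat, Matrix.det_succ_row_zero, Fin.sum_univ_succ, Fin.succAbove]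
  ring

theorem det_cMat (p q : ℝ) : (cMat p q).det = 1 := by
  simp [cMat, Matrix.det_succ_row_zero, Fin.sum_univ_succ, Fin.succAbove]
  ring

set_option maxHeartbeats 4000000 in
/-- The first relator of vol3 in terms of `U`, `C`, with half of its letters moved to the right. -/
theorem uMat_cMat_first_relation (p q k : ℝ) (h : 2 * p * q = 1)
    (hk : (p + q) ^ 2 * (1 - k ^ 2) = 3) :
    (uMat k * cMat p q * vMat k * cMat p q * vMat k) *
        (cMat p q * uMat k * cMat p q * vMat k * cMat p q) =
      (cMat p q * vMat k * cMat p q * uMat k * cMat p q) *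
        (vMat k * cMat p q * vMat k * cMat p q * uMat k) := by
  simp only [uMat, vMat, cMat]
  simp
  split_ands <;> grind

set_option maxHeartbeats 4000000 in
/-- The second relator of vol3 in terms of `U`, `C`, with half of its letters moved to the right. -/
theorem uMat_cMat_second_relation (p q k : ℝ) (h : 2 * p * q = 1)
    (hk : (p + q) ^ 2 * (1 - k ^ 2) = 3) :
    (uMat k * cMat p q * uMat k * cMat p q * vMat k) *
        (cMat p q * dMat * cMat p q * uMat k * cMat p q) =
      (cMat p q * uMat k * cMat p q * dMat * cMat p q) *
        (vMat k * cMat p q * uMat k * cMat p q * uMat k) := by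
  simp only [uMat, vMat, dMat, cMat]
  simp
  split_ands <;> grind

/-- In a group generated by `u` of order dividing four and an involution `c`, the relators of vol3
in `a = u²c` and `b = (aua)⁻¹u` follow from two balanced relations between `u` and `c`. -/
theorem vol3_relators_of_balanced {G : Type*} [Group G] (u c : G) (hu : u ^ 4 = 1)
    (hc : c * c = 1)
    (h₁ : u * c * u⁻¹ * c * u⁻¹ * (c * u * c * u⁻¹ * c) =
      c * u⁻¹ * c * u * c * (u⁻¹ * c * u⁻¹ * c * u))
    (h₂ : u * c * u * c * u⁻¹ * (c * u ^ 2 * c * u * c) =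
      c * u * c * u ^ 2 * c * (u⁻¹ * c * u * c * u))
    (a b : G) (ha : a = u ^ 2 * c) (hb : b = (a * u * a)⁻¹ * u) :
    a * a * b * b * a⁻¹ * b⁻¹ * a⁻¹ * b * b = 1 ∧
      a * b⁻¹ * a * b⁻¹ * a * b * a * a * a * b = 1 := by
  have hci : c⁻¹ = c := inv_eq_of_mul_eq_one_left hc
  have hcc (x : G) : c * (c * x) = x := by rw [← mul_assoc, hc, one_mul]
  have huu : u⁻¹ * u⁻¹ = u * u := by
    rw [← _root_.mul_inv_rev, inv_eq_iff_mul_eq_one, ← hu]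
    simp only [pow_succ, pow_zero, one_mul, mul_assoc]
  have huux (x : G) : u⁻¹ * (u⁻¹ * x) = u * (u * x) := by
    rw [← mul_assoc, huu, mul_assoc]
  have hu3 (x : G) : u * (u * (u * x)) = u⁻¹ * x := by
    rw [← huux (u * x), inv_mul_cancel_left]
  have hb' : b = c * (u * (c * u⁻¹)) := by
    rw [hb, ha]
    simp [pow_two, mul_assoc, hci, huu, by simpa using hu3 1]
  rw [← mul_inv_eq_one] at h₁ h₂
  constructor
  · calc _ = u * (u * c * u⁻¹ * c * u⁻¹ * (c * u * c * u⁻¹ * c) *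
          (c * u⁻¹ * c * u * c * (u⁻¹ * c * u⁻¹ * c * u))⁻¹) * u⁻¹ := by
          rw [hb', ha]
          simp [pow_two, mul_assoc, hci, hcc, huux, hu3]
      _ = 1 := by rw [h₁, mul_one, mul_inv_cancel]
  · calc _ = u * (u * c * u * c * u⁻¹ * (c * u ^ 2 * c * u * c) *
          (c * u * c * u ^ 2 * c * (u⁻¹ * c * u * c * u))⁻¹) * u⁻¹ := by
          rw [hb', ha]
          simp [pow_two, mul_assoc, hci, hcc, huux, hu3]
      _ = 1 := by rw [h₂, mul_one, mul_inv_cancel]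

/-- The explicit 4×4 matrices `U` and `C` satisfy `U⁴ = 1`, `C² = 1`,
`det U = 1`, `det C = 1`, and with `a = U²·C`, `b = (a·U·a)⁻¹·U` the two relators of
vol3 hold, so `(U, C)` defines a representation of vol3/⟨u⟩ (and of vol3) into `SL(4, ℝ)`. -/
theorem vol3_four_dim_representation (t : ℝ) (ht : 1 ≤ t) (s r : ℝ)
    (hs : s = Real.sqrt (t ^ 2 - 1)) (hr : r = Real.sqrt (t ^ 2 + 2))
    (U C : Matrix (Fin 4) (Fin 4) ℝ)
    (hU : U = !![1, 0, 0, 0;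
                 0, 1, 0, 0;
                 0, 0, s / r, 1;
                 0, 0, -(1 + 2 * t ^ 2) / (2 + t ^ 2), -(s / r)])
    (hC : C = !![(t + r) / 2, 0, (1 - t ^ 2 - t * r) / 2, 0;
                 0, (t - r) / 2, 0, (-1 + t ^ 2 - t * r) / 2;
                 1, 0, -(t + r) / 2, 0;
                 0, -1, 0, (-t + r) / 2]) :
    U ^ 4 = 1 ∧ C ^ 2 = 1 ∧ U.det = 1 ∧ C.det = 1 ∧
    ∀ a b : Matrix (Fin 4) (Fin 4) ℝ, a = U ^ 2 * C → b = (a * U * a)⁻¹ * U →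
      a * a * b * b * a⁻¹ * b⁻¹ * a⁻¹ * b * b = 1 ∧
      a * b⁻¹ * a * b⁻¹ * a * b * a * a * a * b = 1 := by
  have ht2 : 0 ≤ t ^ 2 - 1 := by nlinarith
  have hs2 : s ^ 2 = t ^ 2 - 1 := by rw [hs, Real.sq_sqrt ht2]
  have hr2 : r ^ 2 = t ^ 2 + 2 := by rw [hr, Real.sq_sqrt (by positivity)]
  have hr0 : r ≠ 0 := by rintro rfl; nlinarith
  set k := s / r with hk
  set p := (t + r) / 2 with hp
  set q := (r - t) / 2 with hq
  have hk2 : k ^ 2 * (t ^ 2 + 2) = t ^ 2 - 1 := by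
    rw [hk, ← hr2, ← hs2]; field_simp
  have hpq : 2 * p * q = 1 := by rw [hp, hq]; linarith
  have hpqk : (p + q) ^ 2 * (1 - k ^ 2) = 3 := by
    have : p + q = r := by rw [hp, hq]; ring
    rw [this, hr2]; linarith
  have hUk : U = uMat k := by
    have : -(1 + 2 * t ^ 2) / (2 + t ^ 2) = -(1 + k ^ 2) := by
      rw [div_eq_iff (by positivity)]; linarith
    rw [hU, this, uMat]
  have hCpq : C = cMat p q := by
    rw [hC, cMat, hp, hq]
    ext i j
    fin_cases i <;> fin_cases j <;> simp <;> linarith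
  have hU2 : U ^ 2 = dMat := by rw [pow_two, hUk, uMat_mul_self]
  have hU4 : U ^ 4 = 1 := by rw [pow_mul U 2 2, hU2, pow_two, dMat_mul_self]
  have hUV : U * vMat k = 1 := by
    rw [← uMat_mul_dMat, ← hUk, ← hU2, ← hU4]; noncomm_ring
  have hVU : vMat k * U = 1 := mul_eq_one_comm.mp hUV
  have hCC : C * C = 1 := by rw [hCpq, cMat_mul_self]
  refine ⟨hU4, by rw [pow_two, hCC], by rw [hUk, det_uMat], by rw [hCpq, det_cMat], ?_⟩
  let u : (Matrix (Fin 4) (Fin 4) ℝ)ˣ := ⟨U, vMat k, hUV, hVU⟩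
  let c : (Matrix (Fin 4) (Fin 4) ℝ)ˣ := ⟨C, C, hCC, hCC⟩
  have hu : (u : Matrix (Fin 4) (Fin 4) ℝ) = U := rfl
  have hui : ((u⁻¹ : (Matrix (Fin 4) (Fin 4) ℝ)ˣ) : Matrix (Fin 4) (Fin 4) ℝ) = vMat k := rfl
  have hc : (c : Matrix (Fin 4) (Fin 4) ℝ) = C := rfl
  rintro _ _ rfl rfl
  have := vol3_relators_of_balanced u c (Units.ext hU4) (Units.ext hCC)
    (Units.ext (by
      simpa only [Units.val_mul, hu, hui, hc, hUk, hCpq] using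
        uMat_cMat_first_relation p q k hpq hpqk))
    (Units.ext (by
      simpa only [Units.val_mul, Units.val_pow_eq_pow_val, hu, hui, hc, hUk, hCpq, pow_two (uMat k),
        uMat_mul_self] using
        uMat_cMat_second_relation p q k hpq hpqk))
    _ _ rfl rfl
  simpa only [Units.ext_iff, Units.val_mul, Units.val_pow_eq_pow_val, Units.val_one,
    Matrix.coe_units_inv, hu, hc] using this
end

section
/- The matrices U and C preserve the diagonal form M_t in the τ-twisted sense: Ū ᵀ · M_t · U = M_t, where Ū is the matrix obtained from U by replacing s with −s (i.e., Ū = [[1,0,0,0],[0,1,0,0],[0,0,−s/r,1],[0,0,−(1+2t²)/(2+t²),s/r]]), and Cᵀ · M_t · C = M_t. Moreover all four diagonal entries of M_t are nonzero (M_t is invertible). -/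
open Matrix

/-- The matrices `U` and `C` preserve the diagonal form `M_t` in the τ-twisted
sense: `Ūᵀ · M_t · U = M_t` (where `Ū` is `U` with `s` replaced by `−s`) and
`Cᵀ · M_t · C = M_t`; moreover all four diagonal entries of `M_t` are nonzero,
so `M_t` is invertible. -/
theorem vol3_four_dim_invariant_form (t : ℝ) (ht : 1 ≤ t) (s r : ℝ)
    (hs : s = Real.sqrt (t ^ 2 - 1)) (hr : r = Real.sqrt (t ^ 2 + 2))
    (U Ubar C M : Matrix (Fin 4) (Fin 4) ℝ)
    (hU : U = !![1, 0, 0, 0;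
                 0, 1, 0, 0;
                 0, 0, s / r, 1;
                 0, 0, -(1 + 2 * t ^ 2) / (2 + t ^ 2), -(s / r)])
    (hUbar : Ubar = !![1, 0, 0, 0;
                       0, 1, 0, 0;
                       0, 0, -(s / r), 1;
                       0, 0, -(1 + 2 * t ^ 2) / (2 + t ^ 2), s / r])
    (hC : C = !![(t + r) / 2, 0, (1 - t ^ 2 - t * r) / 2, 0;
                 0, (t - r) / 2, 0, (-1 + t ^ 2 - t * r) / 2;
                 1, 0, -(t + r) / 2, 0;
                 0, -1, 0, (-t + r) / 2])
    (hM : M = Matrix.diagonal ![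
        -(2 * r) / (2 * t + t ^ 3 - r + t ^ 2 * r),
        2 * (2 + t ^ 2) / ((1 + 2 * t ^ 2) * (1 - t ^ 2 + t * r)),
        1,
        (2 + t ^ 2) / (1 + 2 * t ^ 2)]) :
    Ubarᵀ * M * U = M ∧ Cᵀ * M * C = M ∧ (∀ i : Fin 4, M i i ≠ 0) ∧ IsUnit M := by
  have ht0 : 0 < t := by linarith
  have hr2 : r ^ 2 = t ^ 2 + 2 := by rw [hr, Real.sq_sqrt (by positivity)]
  have hs2 : s ^ 2 = t ^ 2 - 1 := by rw [hs, Real.sq_sqrt (by nlinarith)]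
  have hr0 : 0 < r := by rw [hr]; positivity
  have htr : t < r := by nlinarith
  -- Write the form as `diag(1/q, d/w, 1, d)`, with `q` and `-w` the upper right entries of `C`.
  obtain ⟨q, hq⟩ : ∃ q, q = (1 - t ^ 2 - t * r) / 2 := ⟨_, rfl⟩
  obtain ⟨w, hw⟩ : ∃ w, w = (1 - t ^ 2 + t * r) / 2 := ⟨_, rfl⟩
  obtain ⟨d, hd⟩ : ∃ d, d = (2 + t ^ 2) / (1 + 2 * t ^ 2) := ⟨_, rfl⟩
  have hq0 : q ≠ 0 := by nlinarith
  have hw0 : w ≠ 0 := by nlinarith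
  have hd0 : d ≠ 0 := by rw [hd]; positivity
  have hqp : q = 1 - ((t + r) / 2) ^ 2 := by rw [hq]; linear_combination hr2 / 4
  have hwp : w = 1 - ((t - r) / 2) ^ 2 := by rw [hw]; linear_combination hr2 / 4
  have hda : -(2 * r) / (2 * t + t ^ 3 - r + t ^ 2 * r) = 1 / q := by
    have h : 2 * t + t ^ 3 - r + t ^ 2 * r = -(2 * r) * q := by
      rw [hq]; linear_combination -t * hr2
    rw [h]; field_simp
  have hdb : 2 * (2 + t ^ 2) / ((1 + 2 * t ^ 2) * (1 - t ^ 2 + t * r)) = d / w := by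
    have h : 1 - t ^ 2 + t * r = 2 * w := by rw [hw]; ring
    rw [h, hd]; field_simp
  have hk : -(1 + 2 * t ^ 2) / (2 + t ^ 2) = -(1 / d) := by rw [hd]; field_simp
  have hc : (-1 + t ^ 2 - t * r) / 2 = -w := by rw [hw]; ring
  have hsr : (s / r) ^ 2 = 1 / d - 1 := by
    rw [div_pow, hs2, hr2, hd]; field_simp; ring
  rw [hda, hdb, ← hd] at hM
  rw [hk] at hU hUbar
  rw [← hq, hc] at hC
  have hne : ∀ i : Fin 4, M i i ≠ 0 := by
    intro i
    fin_cases i <;> simp [hM, hq0, hw0, hd0]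
  refine ⟨?_, ?_, hne, ?_⟩
  · generalize s / r = x at *
    subst hU hUbar hM
    ext i j
    fin_cases i <;> fin_cases j <;>
      simp [Matrix.mul_apply, Fin.sum_univ_four, Matrix.diagonal_apply, hd0]
    · linear_combination -hsr
    · linear_combination -d * hsr - mul_one_div_cancel hd0
  · subst hC hM
    ext i j
    fin_cases i <;> fin_cases j <;>
      simp [Matrix.mul_apply, Fin.sum_univ_four, Matrix.diagonal_apply] <;>
      field_simp <;> grind
  · rw [Matrix.isUnit_iff_isUnit_det, hM, Matrix.det_diagonal, isUnit_iff_ne_zero]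
    refine Finset.prod_ne_zero_iff.mpr fun i _ => ?_
    simpa [hM] using hne i
end

section
/- The explicit 8×8 matrices U₈ and C₈ satisfy: det U₈ = 1, det C₈ = 1, U₈⁴ = I, C₈² = I, and, setting a = U₈²·C₈ and b = (a·U₈·a)⁻¹·U₈, the two relator identities a·a·b·b·a⁻¹·b⁻¹·a⁻¹·b·b = I and a·b⁻¹·a·b⁻¹·a·b·a·a·a·b = I hold. (Hence (U₈, C₈) defines a representation ω_t of vol3/⟨u⟩, and hence of vol3, into SL(8, ℝ).) -/
open Matrix

namespace VolThree

/-- If `u ^ 4 = c ^ 2 = 1`, the two relators of vol3 at `a = u²c`, `b = (aua)⁻¹u` follow from two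
relations between `u` and its conjugate `w = cuc`. -/
theorem relators_of_conj_relations {G : Type*} [Group G] {u c w : G}
    (hu : u ^ 4 = 1) (hc : c ^ 2 = 1) (hw : w = c * u * c)
    (h₁ : w⁻¹ * u⁻¹ * w * u⁻¹ * w⁻¹ = u⁻¹ * w⁻¹ * u * w⁻¹ * u⁻¹)
    (h₂ : w * u⁻¹ * w * w * u * w⁻¹ = u⁻¹ * w * u * u * w⁻¹ * u)
    {a b : G} (ha : a = u ^ 2 * c) (hb : b = (a * u * a)⁻¹ * u) :
    a * a * b * b * a⁻¹ * b⁻¹ * a⁻¹ * b * b = 1 ∧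
      a * b⁻¹ * a * b⁻¹ * a * b * a * a * a * b = 1 := by
  have hcc : c * c = 1 := by rw [← sq, hc]
  have hci : c⁻¹ = c := inv_eq_of_mul_eq_one_left hcc
  have hcc' (x : G) : c * (c * x) = x := by rw [← mul_assoc, hcc, one_mul]
  have hwi : w⁻¹ = c * u⁻¹ * c := by rw [hw]; simp [hci, mul_assoc]
  have hcu (x : G) : c * (u * x) = w * (c * x) := by rw [hw]; simp [mul_assoc, hcc']
  have hcu' (x : G) : c * (u⁻¹ * x) = w⁻¹ * (c * x) := by rw [hwi]; simp [mul_assoc, hcc']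
  have hcw (x : G) : c * (w * x) = u * (c * x) := by rw [hw]; simp [mul_assoc, hcc']
  have hcw' (x : G) : c * (w⁻¹ * x) = u⁻¹ * (c * x) := by rw [hwi]; simp [mul_assoc, hcc']
  have huu (x : G) : u * (u * x) = u⁻¹ * (u⁻¹ * x) := by
    rw [eq_inv_mul_iff_mul_eq, eq_inv_mul_iff_mul_eq]
    simpa [pow_succ, mul_assoc] using congrArg (· * x) hu
  have hww (x : G) : w * (w * x) = w⁻¹ * (w⁻¹ * x) := by
    rw [← hcc' (w * (w * x)), hcw, hcw, huu, hcu', hcu', hcc']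
  have hu3 (x : G) : u⁻¹ * (u⁻¹ * (u⁻¹ * x)) = u * x := by
    rw [← huu]; simp
  have hu4 (x : G) : u * (u * (u * (u * x))) = x := by
    rw [huu]; simp
  have hu3' (x : G) : u * (u * (u * x)) = u⁻¹ * x := by
    rw [huu]; simp
  have hbw : b = w * u⁻¹ := by
    rw [hb, ha]
    simp only [sq, _root_.mul_inv_rev, mul_assoc, hci, hcu', hcc']
    rw [← hww]
    simp
  have r₁ : u * u * w⁻¹ * u⁻¹ * w * u⁻¹ * w⁻¹ * u * w * u⁻¹ * w * u⁻¹ = 1 := by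
    have := congrArg (fun x => u * (u * (x * (u * w * u⁻¹ * w * u⁻¹)))) h₁
    simpa [mul_assoc] using this
  have r₂ : u * u * w * u⁻¹ * w * w * u * w⁻¹ * u⁻¹ * w * u * u * w⁻¹ * u⁻¹ = 1 := by
    have := congrArg (fun x => u * (u * (x * (u⁻¹ * w * u * u * w⁻¹ * u⁻¹)))) h₂
    simpa [mul_assoc, hu4] using this
  have hw3 (x : G) : w * (w * (w * x)) = w⁻¹ * x := by rw [hww]; simp
  subst hbw ha
  constructor
  · rw [← r₁]
    simp only [sq, _root_.mul_inv_rev, mul_assoc, hci, hcu, hcu', hcw', hcc', hcc, inv_inv]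
    simp [hu3, hw3]
  · rw [← r₂]
    simp only [sq, _root_.mul_inv_rev, mul_assoc, hcu, hcu', hcw, hcw', hcc, inv_inv]
    simp [hu3', hw3]

variable {R : Type*} [CommRing R]

/-- The matrix `U₈` in the coordinates `p = t - s`, `q = t + s`. -/
def matU (p q : R) : Matrix (Fin 8) (Fin 8) R :=
  !![1, 0, 0, p + q, -p - q, p + q, 0, 0;
    0, 1, 0, p, -p, p, 1, 0;
    0, 0, 1, -1, 1, -1, 0, 0;
    0, 0, 1, 0, 0, 0, 0, 0;
    0, 0, 1, 0, 0, 1, -p, -q;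
    0, 0, 1, -1, 0, 1, -p, -q;
    0, 0, 0, 0, 0, 0, 0, -1;
    0, 0, 0, 0, 0, 0, 1, 0]

variable (R) in
/-- The matrix `C₈`. -/
def matC : Matrix (Fin 8) (Fin 8) R :=
  !![0, 0, 1, 0, 0, 0, 0, 0;
    0, 0, 0, 1, 0, 0, 0, 0;
    1, 0, 0, 0, 0, 0, 0, 0;
    0, 1, 0, 0, 0, 0, 0, 0;
    0, 0, 0, 0, 0, 0, -1, 1;
    0, 0, 0, 0, 0, 0, -1, 0;
    0, 0, 0, 0, 0, -1, 0, 0;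
    0, 0, 0, 0, 1, -1, 0, 0]

/-- The inverse of `matU p q`, when `p * q = 1`. -/
def matV (p q : R) : Matrix (Fin 8) (Fin 8) R :=
  !![1, 0, p + q, -p - q, 0, 0, 0, 0;
    0, 1, p, -p, 0, 0, 0, -1;
    0, 0, 0, 1, 0, 0, 0, 0;
    0, 0, 0, 0, 1, -1, 0, 0;
    0, 0, 1, -2, 2, -1, -q, p;
    0, 0, 0, -1, 1, 0, -q, p;
    0, 0, 0, 0, 0, 0, 0, 1;
    0, 0, 0, 0, 0, 0, -1, 0]

/-- The conjugate of `matU p q` by `matC R`. -/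
def matW (p q : R) : Matrix (Fin 8) (Fin 8) R :=
  !![1, -1, 0, 0, 0, 0, 0, 1;
    1, 0, 0, 0, 0, 0, 0, 0;
    0, p + q, 1, 0, 0, 0, 0, -p - q;
    0, p, 0, 1, 0, -1, 0, -p;
    0, 0, 0, 0, 1, -2, 0, 0;
    0, 0, 0, 0, 1, -1, 0, 0;
    -1, 1, 0, 0, q, -p - q, 1, 0;
    0, 1, 0, 0, 0, 0, 0, 0]

/-- The conjugate of `matV p q` by `matC R`. -/
def matX (p q : R) : Matrix (Fin 8) (Fin 8) R :=
  !![0, 1, 0, 0, 0, 0, 0, 0;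
    0, 0, 0, 0, 0, 0, 0, 1;
    p + q, -p - q, 1, 0, 0, 0, 0, 0;
    p, -p, 0, 1, -1, 1, 0, 0;
    0, 0, 0, 0, -1, 2, 0, 0;
    0, 0, 0, 0, -1, 1, 0, 0;
    0, 1, 0, 0, -p, p - q, 1, -1;
    1, -1, 0, 0, 0, 0, 0, 1]

theorem matU_pow_three (p q : R) : matU p q ^ 3 = matV p q := by
  simp [pow_succ, matU, matV]
  grind

theorem matV_mul_matU (p q : R) : matV p q * matU p q = 1 := by
  simp [matV, matU]
  ext i j
  fin_cases i <;> fin_cases j <;> simp <;> ring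

theorem matC_sq : matC R ^ 2 = 1 := by
  simp [sq, matC]
  ext i j
  fin_cases i <;> fin_cases j <;> rfl

theorem matC_mul_matU_mul_matC (p q : R) : matC R * matU p q * matC R = matW p q := by
  simp [matC, matU, matW]
  grind

theorem matC_mul_matV_mul_matC (p q : R) : matC R * matV p q * matC R = matX p q := by
  simp [matC, matV, matX]
  grind

theorem det_matU (p q : R) : (matU p q).det = 1 := by
  rw [matU, Matrix.det_succ_column_zero]
  simp [Fin.sum_univ_succ]
  rw [Matrix.det_succ_column_zero]
  simp [Fin.sum_univ_succ]
  rw [← Matrix.det_submatrix_equiv_self (finSumFinEquiv : Fin 4 ⊕ Fin 2 ≃ Fin 6)]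
  trans (fromBlocks !![1, -1, 1, -1; 1, 0, 0, 0; 1, 0, 0, 1; 1, -1, 0, 1]
    !![0, 0; 0, 0; -p, -q; -p, -q] 0 !![0, -1; 1, 0]).det
  · congr 1
    ext (i | i) (j | j) <;> fin_cases i <;> fin_cases j <;> rfl
  · rw [Matrix.det_fromBlocks_zero₂₁]
    simp [Matrix.det_succ_row_zero, Fin.sum_univ_succ, Fin.succAbove]

theorem det_matC : (matC R).det = 1 := by
  rw [← Matrix.det_submatrix_equiv_self (finSumFinEquiv : Fin 4 ⊕ Fin 4 ≃ Fin 8)]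
  trans (fromBlocks !![0, 0, 1, 0; 0, 0, 0, 1; 1, 0, 0, 0; 0, 1, 0, 0] 0 0
    !![0, 0, -1, 1; 0, 0, -1, 0; 0, -1, 0, 0; 1, -1, 0, 0] : Matrix _ _ R).det
  · congr 1
    ext (i | i) (j | j) <;> fin_cases i <;> fin_cases j <;> rfl
  · rw [Matrix.det_fromBlocks_zero₂₁]
    simp [Matrix.det_succ_row_zero, Fin.sum_univ_succ, Fin.succAbove]
    ring

set_option maxHeartbeats 1000000 in
theorem matX_relation {p q : R} (h : p * q = 1) :
    matX p q * matV p q * matW p q * matV p q * matX p q =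
      matV p q * matX p q * matU p q * matX p q * matV p q := by
  simp [matU, matV, matW, matX]
  revert h
  grind

set_option maxHeartbeats 1000000 in
theorem matW_relation {p q : R} (h : p * q = 1) :
    matW p q * matV p q * matW p q * matW p q * matU p q * matX p q =
      matV p q * matW p q * matU p q * matU p q * matX p q * matU p q := by
  simp [matU, matV, matW, matX]
  revert h
  grind

end VolThree

open VolThree

/-- The explicit 8×8 matrices `U₈` and `C₈` satisfy `det U₈ = 1`, `det C₈ = 1`,
`U₈⁴ = 1`, `C₈² = 1`, and the two relators of vol3 hold for `a = U₈²·C₈`,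
`b = (a·U₈·a)⁻¹·U₈`; hence `(U₈, C₈)` defines a representation `ω_t` of vol3/⟨u⟩
(and of vol3) into `SL(8, ℝ)`. -/
theorem vol3_eight_dim_representation (t s : ℝ) (hs : s ^ 2 = t ^ 2 - 1)
    (U₈ C₈ : Matrix (Fin 8) (Fin 8) ℝ)
    (hU₈ : U₈ = !![1, 0, 0, 2*t, -(2*t), 2*t, 0, 0;
                   0, 1, 0, t - s, -t + s, t - s, 1, 0;
                   0, 0, 1, -1, 1, -1, 0, 0;
                   0, 0, 1, 0, 0, 0, 0, 0;
                   0, 0, 1, 0, 0, 1, -t + s, -t - s;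
                   0, 0, 1, -1, 0, 1, -t + s, -t - s;
                   0, 0, 0, 0, 0, 0, 0, -1;
                   0, 0, 0, 0, 0, 0, 1, 0])
    (hC₈ : C₈ = !![0, 0, 1, 0, 0, 0, 0, 0;
                   0, 0, 0, 1, 0, 0, 0, 0;
                   1, 0, 0, 0, 0, 0, 0, 0;
                   0, 1, 0, 0, 0, 0, 0, 0;
                   0, 0, 0, 0, 0, 0, -1, 1;
                   0, 0, 0, 0, 0, 0, -1, 0;
                   0, 0, 0, 0, 0, -1, 0, 0;
                   0, 0, 0, 0, 1, -1, 0, 0]) :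
    U₈.det = 1 ∧ C₈.det = 1 ∧ U₈ ^ 4 = 1 ∧ C₈ ^ 2 = 1 ∧
    ∀ a b : Matrix (Fin 8) (Fin 8) ℝ, a = U₈ ^ 2 * C₈ → b = (a * U₈ * a)⁻¹ * U₈ →
      a * a * b * b * a⁻¹ * b⁻¹ * a⁻¹ * b * b = 1 ∧
      a * b⁻¹ * a * b⁻¹ * a * b * a * a * a * b = 1 := by
  obtain rfl : U₈ = matU (t - s) (t + s) := by rw [hU₈]; simp [matU]; ring_nf; simp
  obtain rfl : C₈ = matC ℝ := hC₈
  have hpq : (t - s) * (t + s) = 1 := by linear_combination -hs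
  generalize t - s = p, t + s = q at hpq ⊢
  have hVU := matV_mul_matU p q
  have hUV := mul_eq_one_comm.mp hVU
  have hC := matC_sq (R := ℝ)
  have hU4 : matU p q ^ 4 = 1 := by rw [pow_succ, matU_pow_three, hVU]
  refine ⟨det_matU p q, det_matC, hU4, hC, ?_⟩
  rintro a b rfl rfl
  let u : (Matrix (Fin 8) (Fin 8) ℝ)ˣ := ⟨matU p q, matV p q, hUV, hVU⟩
  let c : (Matrix (Fin 8) (Fin 8) ℝ)ˣ := ⟨matC ℝ, matC ℝ, by rw [← sq, hC], by rw [← sq, hC]⟩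
  let w : (Matrix (Fin 8) (Fin 8) ℝ)ˣ := c * u * c
  have hw : (w : Matrix (Fin 8) (Fin 8) ℝ) = matW p q := matC_mul_matU_mul_matC p q
  have hwi : ((w⁻¹ : (Matrix (Fin 8) (Fin 8) ℝ)ˣ) : Matrix (Fin 8) (Fin 8) ℝ) = matX p q := by
    rw [← matC_mul_matV_mul_matC, mul_assoc]; rfl
  have hui : ((u⁻¹ : (Matrix (Fin 8) (Fin 8) ℝ)ˣ) : Matrix (Fin 8) (Fin 8) ℝ) = matV p q := rfl
  have hu : (u : Matrix (Fin 8) (Fin 8) ℝ) = matU p q := rfl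
  have hc : (c : Matrix (Fin 8) (Fin 8) ℝ) = matC ℝ := rfl
  have key := relators_of_conj_relations (u := u) (c := c) (w := w)
    (Units.ext hU4) (Units.ext hC) rfl
    (Units.ext (by simpa only [Units.val_mul, hw, hwi, hu, hui] using matX_relation hpq))
    (Units.ext (by simpa only [Units.val_mul, hw, hwi, hu, hui] using matW_relation hpq)) rfl rfl
  simpa only [Units.ext_iff, Units.val_mul, Units.val_one, Units.val_pow_eq_pow_val,
    Matrix.coe_units_inv, hu, hc] using key
end

section
/- For every real t ≥ 1 there exists an invertible 8×8 real matrix P such that P⁻¹ · (U ⊕ U) · P = U₈ and P⁻¹ · (C ⊕ C) · P = C₈, where U ⊕ U and C ⊕ C denote the 8×8 block-diagonal matrices with two copies of U, respectively C, on the diagonal. (That is, the 8-dimensional representation ω_t is conjugate to ρ_t ⊕ ρ_t.) -/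
open Matrix

/-- If `M, N : K^(n+n) → K^n` are jointly injective, then stacking them gives an invertible `P`
which conjugates `A ⊕ A` to `B` whenever `M` and `N` both intertwine `B` with `A`. -/
theorem exists_conj_fromBlocks_of_intertwine {K : Type*} [Field K] {n : ℕ}
    (M N : Matrix (Fin n) (Fin (n + n)) K)
    (hinj : ∀ v, M *ᵥ v = 0 → N *ᵥ v = 0 → v = 0) :
    ∃ P : Matrix (Fin (n + n)) (Fin (n + n)) K, IsUnit P ∧
      ∀ (A : Matrix (Fin n) (Fin n) K) (B : Matrix (Fin (n + n)) (Fin (n + n)) K),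
        A * M = M * B → A * N = N * B →
        P⁻¹ * reindex finSumFinEquiv finSumFinEquiv (fromBlocks A 0 0 A) * P = B := by
  set P : Matrix (Fin (n + n)) (Fin (n + n)) K :=
    (fromRows M N).submatrix finSumFinEquiv.symm id with hP
  have hunit : IsUnit P := by
    rw [← mulVec_injective_iff_isUnit]
    refine (injective_iff_map_eq_zero P.mulVecLin).2 fun v hv => ?_
    refine hinj v ?_ ?_ <;> funext i
    · simpa [hP, mulVec, dotProduct, -finSumFinEquiv_apply_left] using
        congrFun hv (finSumFinEquiv (Sum.inl i))
    · simpa [hP, mulVec, dotProduct, -finSumFinEquiv_apply_right] using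
        congrFun hv (finSumFinEquiv (Sum.inr i))
  refine ⟨P, hunit, fun A B hM hN => ?_⟩
  have hdet : IsUnit P.det := (isUnit_iff_isUnit_det P).1 hunit
  have hcomm : reindex finSumFinEquiv finSumFinEquiv (fromBlocks A 0 0 A) * P = P * B := by
    have h : fromBlocks A 0 0 A * fromRows M N = fromRows M N * B := by
      rw [fromBlocks_mul_fromRows, fromRows_mul, hM, hN]
      simp
    calc _ = (fromBlocks A 0 0 A * fromRows M N).submatrix finSumFinEquiv.symm id := by
            rw [hP, reindex_apply, submatrix_mul_equiv]
      _ = P * B := by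
            rw [h, hP]; rfl
  rw [mul_assoc, hcomm, ← mul_assoc, nonsing_inv_mul P hdet, one_mul]

/-- First intertwiner from the 8-dimensional to the 4-dimensional representation; the parameters
satisfy `a + b = t`, `a - b = r`, `q = s / r`, `k = 1 + q ^ 2`. -/
def intertwinerOne (t s r q k a b : ℝ) : Matrix (Fin 4) (Fin 8) ℝ :=
  !![1, q - 1, a, (q - 1) * a, (1 - q) * a - (t + q * a - s * q), t + q * a - s * q,
      -((1 - q) * a ^ 2), (1 - q) * a ^ 2 - (a * t - a * s * q + q);
    0, k, 0, k * b, -(k * b) - k * (a - s), k * (a - s),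
      k * b ^ 2, -(k * b ^ 2) + k * b * (s + t);
    0, 0, 1, q - 1, -q, q, -((1 - q) * a), (1 - q) * a - (t - s * q);
    0, 0, 0, -k, k, -k, -(k * b), k * b + k * (r - s)]

/-- Second intertwiner, with the same parameters as `intertwinerOne`. -/
def intertwinerTwo (t s r q a b : ℝ) : Matrix (Fin 4) (Fin 8) ℝ :=
  !![0, -1, 0, -a, a - (s - b), s - b, -a ^ 2, a ^ 2 - a * (s + t);
    1, -1 - q, b, -((1 + q) * b), (1 + q) * b - (t - q * b + q * s), t - q * b + q * s,
      -((1 + q) * b ^ 2), (1 + q) * b ^ 2 - (b * t + b * q * s - q);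
    0, 0, 0, -1, 1, -1, -a, a - (s + r);
    0, 0, -1, 1 + q, -q, q, (1 + q) * b, -((1 + q) * b) + (t + q * s)]

theorem intertwiners_jointly_injective {t s r q k a b : ℝ} (hr : r ≠ 0) (hk : k ≠ 0)
    (hat : a + b = t) (har : a - b = r) (hqr : q * r = s)
    (v : Fin 8 → ℝ) (h₁ : intertwinerOne t s r q k a b *ᵥ v = 0)
    (h₂ : intertwinerTwo t s r q a b *ᵥ v = 0) : v = 0 := by
  have e0 := congrFun h₁ 0
  have e1 := congrFun h₁ 1
  have e2 := congrFun h₁ 2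
  have e3 := congrFun h₁ 3
  have f0 := congrFun h₂ 0
  have f1 := congrFun h₂ 1
  have f2 := congrFun h₂ 2
  have f3 := congrFun h₂ 3
  simp only [intertwinerOne, intertwinerTwo, mulVec, dotProduct, Fin.sum_univ_eight, of_apply,
    cons_val, Pi.zero_apply] at e0 e1 e2 e3 f0 f1 f2 f3
  have e1' : v 1 + b * v 3 + (-b - (a - s)) * v 4 + (a - s) * v 5 + b ^ 2 * v 6
      + (-b ^ 2 + b * (s + t)) * v 7 = 0 :=
    mul_left_cancel₀ hk (by linear_combination e1)
  have e3' : -v 3 + v 4 - v 5 - b * v 6 + (b + (r - s)) * v 7 = 0 :=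
    mul_left_cancel₀ hk (by linear_combination e3)
  subst hat har hqr
  have h76 : v 7 - v 6 = 0 := mul_left_cancel₀ hr (by linear_combination e2 + q * f2 + f3 + q * e3')
  have h7 : -(v 7 - v 6) + 2 * v 7 = 0 := mul_left_cancel₀ hr (by linear_combination -f2 + e3')
  have h7' : v 7 = 0 := by linarith
  have h6' : v 6 = 0 := by linarith
  simp only [h6', h7', mul_zero, add_zero] at e0 e1' e2 e3' f0 f1 f2 f3
  have h4' : v 4 = 0 :=
    mul_left_cancel₀ hr (by linear_combination e0 + q * f0 - f1 - q * e1' - (a - b) * (e2 + q * f2))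
  have h5' : -v 4 - 2 * (v 5 - v 4) = 0 :=
    mul_left_cancel₀ hr (by linear_combination -f0 - e1' + (a - b) * f2)
  have h5'' : v 5 = 0 := by linarith
  simp only [h4', h5'', mul_zero, add_zero] at e0 e1' e2 e3' f0 f1 f2 f3
  have h3' : v 3 = 0 := by linarith
  simp only [h3', mul_zero, add_zero] at e0 e1' e2 e3' f0 f1 f2 f3
  have h2' : v 2 = 0 := by linarith
  have h1' : v 1 = 0 := by linarith
  simp only [h1', h2', mul_zero, add_zero] at e0
  have h0' : v 0 = 0 := by linarith
  funext i
  fin_cases i <;> assumption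

theorem intertwinerOne_orderFour {t s r q k a b : ℝ} (hka : k = 1 + q ^ 2) (hat : a + b = t)
    (har : a - b = r) (hab : a * b = -(1 / 2)) (hqr : q * r = s) :
    (!![1, 0, 0, 0; 0, 1, 0, 0; 0, 0, q, 1; 0, 0, -k, -q] :
        Matrix (Fin 4) (Fin 4) ℝ) * intertwinerOne t s r q k a b =
      intertwinerOne t s r q k a b *
        (!![1, 0, 0, 2*t, -(2*t), 2*t, 0, 0;
          0, 1, 0, t - s, -t + s, t - s, 1, 0;
          0, 0, 1, -1, 1, -1, 0, 0;
          0, 0, 1, 0, 0, 0, 0, 0;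
          0, 0, 1, 0, 0, 1, -t + s, -t - s;
          0, 0, 1, -1, 0, 1, -t + s, -t - s;
          0, 0, 0, 0, 0, 0, 0, -1;
          0, 0, 0, 0, 0, 0, 1, 0] : Matrix (Fin 8) (Fin 8) ℝ) := by
  ext i j
  fin_cases i <;> fin_cases j <;>
    simp only [intertwinerOne, Matrix.mul_apply, Fin.sum_univ_four, Fin.sum_univ_eight, of_apply,
      cons_val, Fin.zero_eta, Fin.mk_one, Fin.reduceFinMk] <;> grind

theorem intertwinerOne_involution {t s r q k a b : ℝ} (hat : a + b = t)
    (har : a - b = r) (hab : a * b = -(1 / 2)) :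
    (!![a, 0, 1 - a ^ 2, 0; 0, b, 0, b ^ 2 - 1; 1, 0, -a, 0; 0, -1, 0, -b] :
        Matrix (Fin 4) (Fin 4) ℝ) * intertwinerOne t s r q k a b =
      intertwinerOne t s r q k a b *
        (!![0, 0, 1, 0, 0, 0, 0, 0;
          0, 0, 0, 1, 0, 0, 0, 0;
          1, 0, 0, 0, 0, 0, 0, 0;
          0, 1, 0, 0, 0, 0, 0, 0;
          0, 0, 0, 0, 0, 0, -1, 1;
          0, 0, 0, 0, 0, 0, -1, 0;
          0, 0, 0, 0, 0, -1, 0, 0;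
          0, 0, 0, 0, 1, -1, 0, 0] : Matrix (Fin 8) (Fin 8) ℝ) := by
  ext i j
  fin_cases i <;> fin_cases j <;>
    simp only [intertwinerOne, Matrix.mul_apply, Fin.sum_univ_four, Fin.sum_univ_eight, of_apply,
      cons_val, Fin.zero_eta, Fin.mk_one, Fin.reduceFinMk] <;> grind

theorem intertwinerTwo_orderFour {t s r q k a b : ℝ} (hka : k = 1 + q ^ 2) (hat : a + b = t)
    (har : a - b = r) (hab : a * b = -(1 / 2)) (hqr : q * r = s) :
    (!![1, 0, 0, 0; 0, 1, 0, 0; 0, 0, q, 1; 0, 0, -k, -q] :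
        Matrix (Fin 4) (Fin 4) ℝ) * intertwinerTwo t s r q a b =
      intertwinerTwo t s r q a b *
        (!![1, 0, 0, 2*t, -(2*t), 2*t, 0, 0;
          0, 1, 0, t - s, -t + s, t - s, 1, 0;
          0, 0, 1, -1, 1, -1, 0, 0;
          0, 0, 1, 0, 0, 0, 0, 0;
          0, 0, 1, 0, 0, 1, -t + s, -t - s;
          0, 0, 1, -1, 0, 1, -t + s, -t - s;
          0, 0, 0, 0, 0, 0, 0, -1;
          0, 0, 0, 0, 0, 0, 1, 0] : Matrix (Fin 8) (Fin 8) ℝ) := by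
  ext i j
  fin_cases i <;> fin_cases j <;>
    simp only [intertwinerTwo, Matrix.mul_apply, Fin.sum_univ_four, Fin.sum_univ_eight, of_apply,
      cons_val, Fin.zero_eta, Fin.mk_one, Fin.reduceFinMk] <;> grind

theorem intertwinerTwo_involution {t s r q a b : ℝ} (hat : a + b = t)
    (har : a - b = r) (hab : a * b = -(1 / 2)) :
    (!![a, 0, 1 - a ^ 2, 0; 0, b, 0, b ^ 2 - 1; 1, 0, -a, 0; 0, -1, 0, -b] :
        Matrix (Fin 4) (Fin 4) ℝ) * intertwinerTwo t s r q a b =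
      intertwinerTwo t s r q a b *
        (!![0, 0, 1, 0, 0, 0, 0, 0;
          0, 0, 0, 1, 0, 0, 0, 0;
          1, 0, 0, 0, 0, 0, 0, 0;
          0, 1, 0, 0, 0, 0, 0, 0;
          0, 0, 0, 0, 0, 0, -1, 1;
          0, 0, 0, 0, 0, 0, -1, 0;
          0, 0, 0, 0, 0, -1, 0, 0;
          0, 0, 0, 0, 1, -1, 0, 0] : Matrix (Fin 8) (Fin 8) ℝ) := by
  ext i j
  fin_cases i <;> fin_cases j <;>
    simp only [intertwinerTwo, Matrix.mul_apply, Fin.sum_univ_four, Fin.sum_univ_eight, of_apply,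
      cons_val, Fin.zero_eta, Fin.mk_one, Fin.reduceFinMk] <;> grind

/-- For every real `t ≥ 1` there is an invertible 8×8 real matrix `P` with
`P⁻¹ · (U ⊕ U) · P = U₈` and `P⁻¹ · (C ⊕ C) · P = C₈`; that is, the 8-dimensional
representation `ω_t` is conjugate to `ρ_t ⊕ ρ_t`. -/
theorem eight_dim_rep_conjugate_to_double (t : ℝ) (ht : 1 ≤ t) (s r : ℝ)
    (hs : s = Real.sqrt (t ^ 2 - 1)) (hr : r = Real.sqrt (t ^ 2 + 2))
    (U C : Matrix (Fin 4) (Fin 4) ℝ)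
    (hU : U = !![1, 0, 0, 0;
                 0, 1, 0, 0;
                 0, 0, s / r, 1;
                 0, 0, -(1 + 2 * t ^ 2) / (2 + t ^ 2), -(s / r)])
    (hC : C = !![(t + r) / 2, 0, (1 - t ^ 2 - t * r) / 2, 0;
                 0, (t - r) / 2, 0, (-1 + t ^ 2 - t * r) / 2;
                 1, 0, -(t + r) / 2, 0;
                 0, -1, 0, (-t + r) / 2])
    (U₈ C₈ : Matrix (Fin 8) (Fin 8) ℝ)
    (hU₈ : U₈ = !![1, 0, 0, 2*t, -(2*t), 2*t, 0, 0;
                   0, 1, 0, t - s, -t + s, t - s, 1, 0;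
                   0, 0, 1, -1, 1, -1, 0, 0;
                   0, 0, 1, 0, 0, 0, 0, 0;
                   0, 0, 1, 0, 0, 1, -t + s, -t - s;
                   0, 0, 1, -1, 0, 1, -t + s, -t - s;
                   0, 0, 0, 0, 0, 0, 0, -1;
                   0, 0, 0, 0, 0, 0, 1, 0])
    (hC₈ : C₈ = !![0, 0, 1, 0, 0, 0, 0, 0;
                   0, 0, 0, 1, 0, 0, 0, 0;
                   1, 0, 0, 0, 0, 0, 0, 0;
                   0, 1, 0, 0, 0, 0, 0, 0;
                   0, 0, 0, 0, 0, 0, -1, 1;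
                   0, 0, 0, 0, 0, 0, -1, 0;
                   0, 0, 0, 0, 0, -1, 0, 0;
                   0, 0, 0, 0, 1, -1, 0, 0]) :
    ∃ P : Matrix (Fin 8) (Fin 8) ℝ, IsUnit P ∧
      P⁻¹ * (Matrix.reindex finSumFinEquiv finSumFinEquiv (Matrix.fromBlocks U 0 0 U)) * P
        = U₈ ∧
      P⁻¹ * (Matrix.reindex finSumFinEquiv finSumFinEquiv (Matrix.fromBlocks C 0 0 C)) * P
        = C₈ := by
  have hr2 : r ^ 2 = t ^ 2 + 2 := by rw [hr, Real.sq_sqrt (by positivity)]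
  have hs2 : s ^ 2 = t ^ 2 - 1 := by rw [hs, Real.sq_sqrt (by nlinarith)]
  have hr0 : r ≠ 0 := by rintro rfl; nlinarith [sq_nonneg t]
  obtain ⟨q, hq⟩ : ∃ q, q = s / r := ⟨_, rfl⟩
  obtain ⟨k, hk⟩ : ∃ k, k = 1 + q ^ 2 := ⟨_, rfl⟩
  obtain ⟨a, ha⟩ : ∃ a, a = (t + r) / 2 := ⟨_, rfl⟩
  obtain ⟨b, hb⟩ : ∃ b, b = (t - r) / 2 := ⟨_, rfl⟩
  have hqr : q * r = s := by rw [hq]; field_simp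
  have hk0 : k ≠ 0 := by rw [hk]; positivity
  have hU21 : -(1 + 2 * t ^ 2) / (2 + t ^ 2) = -k := by
    rw [hk, hq, div_pow, hs2, hr2]
    field_simp
    ring
  have hat : a + b = t := by rw [ha, hb]; ring
  have har : a - b = r := by rw [ha, hb]; ring
  have hab : a * b = -(1 / 2) := by rw [ha, hb]; linear_combination -(1 / 4) * hr2
  rw [hU21, ← hq] at hU
  have hC' : C = !![a, 0, 1 - a ^ 2, 0; 0, b, 0, b ^ 2 - 1; 1, 0, -a, 0; 0, -1, 0, -b] := by
    rw [hC, ha, hb]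
    ext i j
    fin_cases i <;> fin_cases j <;> simp <;> linarith [hr2]
  obtain ⟨P, hP, hconj⟩ := exists_conj_fromBlocks_of_intertwine (n := 4)
    (intertwinerOne t s r q k a b) (intertwinerTwo t s r q a b)
    (intertwiners_jointly_injective hr0 hk0 hat har hqr)
  refine ⟨P, hP, hconj U U₈ ?_ ?_, hconj C C₈ ?_ ?_⟩
  · rw [hU, hU₈]
    exact intertwinerOne_orderFour hk hat har hab hqr
  · rw [hU, hU₈]
    exact intertwinerTwo_orderFour hk hat har hab hqr
  · rw [hC', hC₈]
    exact intertwinerOne_involution hat har hab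
  · rw [hC', hC₈]
    exact intertwinerTwo_involution hat har hab
end

section
/- Let u = t₁ + y₁√d ∈ ℤ[√d] and for n ≥ 1 let t_n ∈ ℤ be the rational part of uⁿ (so uⁿ = t_n + y_n√d). Then the set of rational primes p such that p divides t_n for some n ≥ 1 is infinite. In particular, there exist a strictly increasing sequence of primes p_k → ∞ and indices n_k with p_k dividing t_{n_k}. -/
/-- The duplication formula for the rational part of an element of norm one. -/
lemma Zsqrtd.re_sq_of_norm_eq_one {d : ℤ} {z : ℤ√d} (hz : z.norm = 1) :
    (z ^ 2).re = 2 * z.re ^ 2 - 1 := by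
  rw [Zsqrtd.norm_def] at hz
  rw [pow_two, Zsqrtd.re_mul]
  linarith

lemma two_le_of_duplication {s : ℕ → ℤ} (hs : ∀ k, s (k + 1) = 2 * s k ^ 2 - 1)
    (h0 : 2 ≤ s 0) (k : ℕ) : 2 ≤ s k := by
  induction k with
  | zero => exact h0
  | succ k ih => rw [hs]; nlinarith

lemma dvd_sub_one_of_duplication {s : ℕ → ℤ} (hs : ∀ k, s (k + 1) = 2 * s k ^ 2 - 1)
    {p : ℤ} {k : ℕ} (hp : p ∣ s k) (j : ℕ) :
    p ∣ s (k + 2 + j) - 1 := by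
  induction j with
  | zero =>
    have h : s (k + 2 + 0) - 1 = s k * (8 * s k * (s k ^ 2 - 1)) := by
      rw [add_zero, hs (k + 1), hs k]; ring
    exact h ▸ hp.mul_right _
  | succ j ih =>
    have h : s (k + 2 + (j + 1)) - 1 = (s (k + 2 + j) - 1) * (2 * (s (k + 2 + j) + 1)) := by
      rw [← add_assoc, hs]; ring
    exact h ▸ ih.mul_right _

lemma dvd_one_of_duplication {s : ℕ → ℤ} (hs : ∀ k, s (k + 1) = 2 * s k ^ 2 - 1)
    {p : ℤ} {k l : ℕ} (hkl : k < l) (hk : p ∣ s k) (hl : p ∣ s l) :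
    p ∣ 1 := by
  obtain ⟨j, rfl⟩ := Nat.exists_eq_add_of_lt hkl
  cases j with
  | zero =>
    have h : (1 : ℤ) = s k * (2 * s k) - s (k + 0 + 1) := by rw [add_zero, hs]; ring
    exact h ▸ (hk.mul_right _).sub hl
  | succ j =>
    have h := dvd_sub_one_of_duplication hs hk j
    rw [show k + 2 + j = k + (j + 1) + 1 by ring] at h
    simpa using hl.sub h

lemma infinite_primes_dvd_of_duplication {s : ℕ → ℤ} (hs : ∀ k, s (k + 1) = 2 * s k ^ 2 - 1)
    (h0 : 2 ≤ s 0) :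
    {p : ℕ | p.Prime ∧ ∃ k, (p : ℤ) ∣ s k}.Infinite := by
  have hprime (k : ℕ) : (s k).natAbs.minFac.Prime :=
    Nat.minFac_prime (by have := two_le_of_duplication hs h0 k; omega)
  have hdvd (k : ℕ) : ((s k).natAbs.minFac : ℤ) ∣ s k :=
    Int.natCast_dvd.mpr (Nat.minFac_dvd _)
  refine Set.infinite_of_injective_forall_mem (f := fun k ↦ (s k).natAbs.minFac)
    (Function.Injective.of_lt_imp_ne fun k l hkl heq ↦ ?_) fun k ↦ ⟨hprime k, k, hdvd k⟩
  have h := dvd_one_of_duplication hs hkl (hdvd k) (heq ▸ hdvd l)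
  exact (hprime k).one_lt.ne' (Nat.dvd_one.mp (by exact_mod_cast h))

/-- With `u = t₁ + y₁√d ∈ ℤ[√d]` and `t_n` the rational part of `uⁿ`, the set
of rational primes dividing some `t_n` (`n ≥ 1`) is infinite; in particular there are a
strictly increasing sequence of primes `p_k` and indices `n_k ≥ 1` with `p_k ∣ t_{n_k}`. -/
theorem primitive_prime_divisors_of_pell_traces (d : ℤ) (hd : Squarefree d) (hd2 : 2 ≤ d)
    (t₁ y₁ : ℤ) (ht₁ : 0 < t₁) (hy₁ : 0 < y₁) (hpell : t₁ ^ 2 - d * y₁ ^ 2 = 1) :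
    {p : ℕ | p.Prime ∧ ∃ n : ℕ, 1 ≤ n ∧ (p : ℤ) ∣ ((⟨t₁, y₁⟩ : Zsqrtd d) ^ n).re}.Infinite ∧
    ∃ (p : ℕ → ℕ) (m : ℕ → ℕ), StrictMono p ∧
      ∀ k : ℕ, (p k).Prime ∧ 1 ≤ m k ∧ (p k : ℤ) ∣ ((⟨t₁, y₁⟩ : Zsqrtd d) ^ (m k)).re := by
  have hnorm : (⟨t₁, y₁⟩ : Zsqrtd d).norm = 1 := by
    rw [Zsqrtd.norm_def]; linarith
  have hdup (k : ℕ) : ((⟨t₁, y₁⟩ : Zsqrtd d) ^ 2 ^ (k + 1)).re =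
      2 * ((⟨t₁, y₁⟩ : Zsqrtd d) ^ 2 ^ k).re ^ 2 - 1 := by
    rw [pow_succ 2 k, pow_mul]
    exact Zsqrtd.re_sq_of_norm_eq_one (pow_mem (S := MonoidHom.mker Zsqrtd.normMonoidHom) hnorm _)
  have ht₁_two : 2 ≤ t₁ := by
    have : 0 < d * y₁ ^ 2 := by positivity
    nlinarith
  have hinf : {p : ℕ | p.Prime ∧
      ∃ n : ℕ, 1 ≤ n ∧ (p : ℤ) ∣ ((⟨t₁, y₁⟩ : Zsqrtd d) ^ n).re}.Infinite :=
    (infinite_primes_dvd_of_duplication (s := fun k ↦ ((⟨t₁, y₁⟩ : Zsqrtd d) ^ 2 ^ k).re)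
      hdup (by simpa using ht₁_two)).mono
      (by rintro p ⟨hp, k, hk⟩; exact ⟨hp, 2 ^ k, Nat.one_le_two_pow, hk⟩)
  have hmem := Nat.nth_mem_of_infinite hinf
  choose m hm using fun k ↦ (hmem k).2
  exact ⟨hinf, _, m, Nat.nth_strictMono hinf, fun k ↦ ⟨(hmem k).1, hm k⟩⟩
end

section
/- Let U₀ and C₀ be the explicit 8×8 matrices over the Gaussian integers ℤ[i] obtained by specializing t = 0 and √(t²−1) = i, and set a₀ = U₀²·C₀ and b₀ = (a₀·U₀·a₀)⁻¹·U₀. Then a₀ and b₀ are invertible matrices over ℤ[i], and the subgroup of GL(8, ℤ[i]) generated by a₀ and b₀ is finite of order exactly 320. (That is, the image ω₀(vol3) has order 320, so the kernel Π = Ker(ω₀ : vol3 → SL(8, ℤ[i])) has index 320 in vol3.) -/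
open Matrix

namespace Subgroup

variable {G : Type*} [Group G]

/-- An element semiconjugating every generator into a finite subgroup normalizes it. -/
theorem mem_normalizer_closure {S : Set G} {g : G} [Finite (closure S)]
    (h : ∀ s ∈ S, ∃ w ∈ closure S, g * s = w * g) :
    g ∈ normalizer (closure S : Set G) := by
  have hle : closure S ≤ (closure S).comap (MulAut.conj g).toMonoidHom := by
    rw [closure_le]
    intro s hs
    obtain ⟨w, hw, e⟩ := h s hs
    simpa [e] using hw
  have : Finite (closure S : Set G) := ‹_›
  exact mem_normalizer_fintype fun n hn => hle hn

/-- Adjoining to a finite subgroup a normalizing element of prime order modulo the subgroup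
multiplies the order by that prime. -/
theorem card_closure_insert {S : Set G} {g : G} {p : ℕ} [Fact p.Prime] [Finite (closure S)]
    (hconj : ∀ s ∈ S, ∃ w ∈ closure S, g * s = w * g)
    (hpow : g ^ p ∈ closure S) (hg : g ∉ closure S) :
    Nat.card (closure (insert g S)) = p * Nat.card (closure S) := by
  set N := closure S
  set M := closure (insert g S) with hM
  have hNM : N ≤ M := closure_mono (Set.subset_insert _ _)
  have hgM : g ∈ M := subset_closure (Set.mem_insert _ _)
  have hnorm : M ≤ normalizer (N : Set G) := by
    rw [hM, closure_le, Set.insert_subset_iff]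
    exact ⟨mem_normalizer_closure hconj, subset_closure.trans le_normalizer⟩
  have : (N.subgroupOf M).Normal := (normal_subgroupOf_iff_le_normalizer hNM).2 hnorm
  let γ : M ⧸ N.subgroupOf M := QuotientGroup.mk' _ ⟨g, hgM⟩
  have hγ : orderOf γ = p := by
    refine orderOf_eq_prime ?_ ?_
    · rw [← map_pow]
      exact (QuotientGroup.eq_one_iff _).2 (mem_subgroupOf.2 hpow)
    · exact fun h => hg (mem_subgroupOf.1 ((QuotientGroup.eq_one_iff _).1 h))
  have hgen : M ≤ ((zpowers γ).comap (QuotientGroup.mk' (N.subgroupOf M))).map M.subtype := by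
    conv_lhs => rw [hM]
    rw [closure_le, Set.insert_subset_iff]
    refine ⟨⟨⟨g, hgM⟩, mem_zpowers γ, rfl⟩, fun s hs => ?_⟩
    refine ⟨⟨s, hNM (subset_closure hs)⟩, ?_, rfl⟩
    have : QuotientGroup.mk' (N.subgroupOf M) ⟨s, hNM (subset_closure hs)⟩ = 1 :=
      (QuotientGroup.eq_one_iff _).2 (mem_subgroupOf.2 (subset_closure hs))
    simp only [coe_comap, Set.mem_preimage, SetLike.mem_coe, this, one_mem]
  have htop : ∀ x, x ∈ zpowers γ := by
    intro x
    obtain ⟨m, rfl⟩ := QuotientGroup.mk'_surjective _ x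
    obtain ⟨m', hm', e⟩ := hgen m.2
    rwa [Subtype.ext e] at hm'
  have hindex : N.relIndex M = p := by
    rw [relIndex, index, ← hγ, orderOf_eq_card_of_forall_mem_zpowers htop]
  rw [← hindex, mul_comm, ← relIndex_bot_left, ← relIndex_bot_left,
    relIndex_mul_relIndex _ _ _ bot_le hNM]

theorem notMem_closure_of_not_commute {S : Set G} {c g : G} (hS : ∀ s ∈ S, Commute c s)
    (hg : ¬ Commute c g) : g ∉ closure S := fun h =>
  hg ((mem_centralizer_singleton_iff.1
    ((closure_le _).2 (fun s hs => mem_centralizer_singleton_iff.2 (hS s hs).eq.symm) h :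
      g ∈ centralizer {c})).symm)

/-- A group generated by `a` and `b` with an extraspecial normal subgroup of order `32` generated
by `q₀, q₁, q₂, q₃`, on which `b` acts with order `5` and `a` acts with order `2` modulo inner
automorphisms, has order `320`. -/
theorem card_closure_pair_eq_320 {z q₀ q₁ q₂ q₃ a b : G}
    (hz : z ≠ 1) (hzz : z * z = 1) (hzc : ∀ g, Commute z g)
    (h₀ : q₀ * q₀ = z) (h₁ : q₁ * q₁ = z) (h₂ : q₂ * q₂ = z) (h₃ : q₃ * q₃ = z)
    (h₀₁ : Commute q₀ q₁) (h₁₂ : Commute q₁ q₂) (h₂₃ : Commute q₂ q₃)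
    (h₀₂ : q₀ * q₂ = z * q₂ * q₀) (h₃₀ : q₃ * q₀ = z * q₀ * q₃) (h₁₃ : q₁ * q₃ = z * q₃ * q₁)
    (hb₀ : b * q₀ = q₁ * b) (hb₁ : b * q₁ = q₂ * b) (hb₂ : b * q₂ = q₃ * b)
    (hb₃ : b * q₃ = z * q₀ * q₁ * q₂ * q₃ * b) (hb : b ^ 5 = z)
    (ha : a * a = q₀) (ha₁ : a * q₁ = q₀ * q₁ * q₂ * q₃ * a) (ha₂ : a * q₂ = z * q₃ * a)
    (ha₃ : a * q₃ = q₂ * a) (hab : a * b * (a * b) = z * q₂) :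
    Nat.card (closure {a, b}) = 320 := by
  have anticomm {x y : G} (h : x * y = z * y * x) : ¬ Commute x y := fun hc => hz <| by
    rwa [hc.eq, mul_assoc, right_eq_mul] at h
  have self {S : Set G} {s : G} (hs : s ∈ S) : s ∈ closure S := subset_closure hs
  have sq {x : G} (h : x * x = z) {S : Set G} (hS : z ∈ S) : x ^ 2 ∈ closure S := by
    rw [pow_two, h]; exact self hS
  have finite_of_card {S : Set G} {n : ℕ} (h : Nat.card (closure S) = n) (hn : n ≠ 0) :
      Finite (closure S) := Nat.finite_of_card_ne_zero (h ▸ hn)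
  have ha₀ : a * q₀ = q₀ * a := by rw [← ha, mul_assoc]
  have hab' : a * b = q₂ * b⁻¹ * q₀ * a := by
    refine mul_right_cancel (b := a * b) ?_
    calc a * b * (a * b) = z * q₂ := hab
      _ = q₂ * b⁻¹ * (q₀ * q₀) * b := by
        rw [h₀, (hzc q₂).eq, mul_assoc, mul_assoc, (hzc b).eq, inv_mul_cancel_left]
      _ = q₂ * b⁻¹ * q₀ * a * (a * b) := by
        conv_lhs => enter [1, 2, 2]; rw [← ha]
        simp only [mul_assoc]
  -- The orders of the successive terms of a subnormal series.
  have c_z : Nat.card (closure {z}) = 2 := by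
    have : Finite (closure (∅ : Set G)) := by rw [closure_empty]; infer_instance
    have := card_closure_insert (S := ∅) (g := z) (p := 2) (by simp)
      (by simp [pow_two, hzz]) (by simpa using hz)
    simpa using this
  have := finite_of_card c_z (by simp)
  have c_q₂ : Nat.card (closure {q₂, z}) = 4 := by
    rw [card_closure_insert (p := 2) _ (sq h₂ (by simp)), c_z]
    · exact notMem_closure_of_not_commute (c := q₀) (by simp [(hzc _).symm]) (anticomm h₀₂)
    · rintro s rfl
      exact ⟨s, self (by simp), (hzc _).eq.symm⟩
  have := finite_of_card c_q₂ (by simp)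
  have c_q₀ : Nat.card (closure {q₀, q₂, z}) = 8 := by
    rw [card_closure_insert (p := 2) _ (sq h₀ (by simp)), c_q₂]
    · refine fun h => notMem_closure_of_not_commute (S := {q₂, z}) (c := q₂) ?_ ?_ h
      · simp [(hzc _).symm]
      · exact fun hc => anticomm h₀₂ hc.symm
    · rintro s (rfl | rfl)
      · exact ⟨z * s, mul_mem (self (by simp)) (self (by simp)), h₀₂⟩
      · exact ⟨s, self (by simp), (hzc _).eq.symm⟩
  have := finite_of_card c_q₀ (by simp)
  have q₃_notMem : q₃ ∉ closure {q₀, q₂, z} :=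
    notMem_closure_of_not_commute (c := q₁) (by simp [(hzc _).symm, h₀₁.symm, h₁₂]) (anticomm h₁₃)
  have c_q₃ : Nat.card (closure {q₃, q₀, q₂, z}) = 16 := by
    rw [card_closure_insert (p := 2) _ (sq h₃ (by simp)) q₃_notMem, c_q₀]
    rintro s (rfl | rfl | rfl)
    · exact ⟨z * s, mul_mem (self (by simp)) (self (by simp)), h₃₀⟩
    · exact ⟨s, self (by simp), h₂₃.eq.symm⟩
    · exact ⟨s, self (by simp), (hzc _).eq.symm⟩
  have := finite_of_card c_q₃ (by simp)
  have c_Q : Nat.card (closure {q₁, q₃, q₀, q₂, z}) = 32 := by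
    rw [card_closure_insert (p := 2) _ (sq h₁ (by simp)), c_q₃]
    · refine notMem_closure_of_not_commute (c := q₂ * q₃) ?_ fun hc => ?_
      · have : Commute (q₂ * q₃) q₀ := by
          have h₂₀ : q₂ * q₀ = z * q₀ * q₂ := by
            rw [mul_assoc, h₀₂, mul_assoc, ← mul_assoc, hzz, one_mul]
          rw [Commute, SemiconjBy, mul_assoc, h₃₀, mul_assoc, ← mul_assoc, ← (hzc q₂).eq,
            mul_assoc, ← mul_assoc q₂, h₂₀]
          simp only [← mul_assoc, hzz, one_mul]
        simp [(hzc _).symm, this, h₂₃.mul_left rfl, (Commute.refl q₂).mul_left h₂₃.symm]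
      · have := h₁₂.symm.inv_left.mul_left hc
        rw [inv_mul_cancel_left] at this
        exact anticomm h₁₃ this.symm
    · rintro s (rfl | rfl | rfl | rfl)
      · exact ⟨z * s, mul_mem (self (by simp)) (self (by simp)), h₁₃⟩
      · exact ⟨s, self (by simp), h₀₁.eq.symm⟩
      · exact ⟨s, self (by simp), h₁₂.eq⟩
      · exact ⟨s, self (by simp), (hzc _).eq.symm⟩
  have := finite_of_card c_Q (by simp)
  have mem_Q {x : G} (hx : x ∈ ({q₁, q₃, q₀, q₂, z} : Set G)) :
      x ∈ closure {q₁, q₃, q₀, q₂, z} := self hx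
  have Q_le : closure {q₁, q₃, q₀, q₂, z} ≤ normalizer (closure {q₂, z} : Set G) := by
    rw [closure_le]
    have comm {x : G} (hx : Commute x q₂) : x ∈ normalizer (closure {q₂, z} : Set G) := by
      refine mem_normalizer_closure ?_
      rintro s (rfl | rfl)
      · exact ⟨s, self (by simp), hx.eq⟩
      · exact ⟨s, self (by simp), (hzc _).eq.symm⟩
    rintro x (rfl | rfl | rfl | rfl | rfl)
    · exact comm h₁₂
    · exact comm h₂₃.symm
    · refine mem_normalizer_closure ?_
      rintro s (rfl | rfl)
      · exact ⟨z * s, mul_mem (self (by simp)) (self (by simp)), h₀₂⟩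
      · exact ⟨s, self (by simp), (hzc _).eq.symm⟩
    · exact comm rfl
    · exact comm (hzc _)
  have q₃_notMem' : q₃ ∉ closure {q₂, z} := fun h =>
    q₃_notMem (closure_mono (Set.subset_insert _ _) h)
  have b_notMem : b ∉ closure {q₁, q₃, q₀, q₂, z} := fun h => q₃_notMem' <| by
    have := (Q_le h q₂).1 (self (by simp))
    rwa [hb₂, mul_inv_cancel_right] at this
  have a_notMem : a ∉ closure {q₁, q₃, q₀, q₂, z} := fun h => q₃_notMem' <| by
    have := (Q_le h q₂).1 (self (by simp))
    rw [ha₂, mul_inv_cancel_right] at this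
    exact (mul_mem_cancel_left (self (by simp))).1 this
  have a_conj : ∀ s ∈ ({q₁, q₃, q₀, q₂, z} : Set G),
      ∃ w ∈ closure {q₁, q₃, q₀, q₂, z}, a * s = w * a := by
    rintro s (rfl | rfl | rfl | rfl | rfl)
    · exact ⟨_, mul_mem (mul_mem (mul_mem (mem_Q (by simp)) (mem_Q (by simp)))
        (mem_Q (by simp))) (mem_Q (by simp)), ha₁⟩
    · exact ⟨_, mem_Q (by simp), ha₃⟩
    · exact ⟨_, mem_Q (by simp), ha₀⟩
    · exact ⟨_, mul_mem (mem_Q (by simp)) (mem_Q (by simp)), ha₂⟩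
    · exact ⟨s, mem_Q (by simp), (hzc _).eq.symm⟩
  have c_aQ : Nat.card (closure {a, q₁, q₃, q₀, q₂, z}) = 64 := by
    rw [card_closure_insert (p := 2) a_conj (by rw [pow_two, ha]; exact mem_Q (by simp)) a_notMem,
      c_Q]
  have c_bQ : Nat.card (closure {b, q₁, q₃, q₀, q₂, z}) = 160 := by
    have : Fact (Nat.Prime 5) := ⟨by norm_num⟩
    rw [card_closure_insert (p := 5) _ (by rw [hb]; exact mem_Q (by simp)) b_notMem, c_Q]
    rintro s (rfl | rfl | rfl | rfl | rfl)
    · exact ⟨_, mem_Q (by simp), hb₁⟩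
    · exact ⟨_, mul_mem (mul_mem (mul_mem (mul_mem (mem_Q (by simp)) (mem_Q (by simp)))
        (mem_Q (by simp))) (mem_Q (by simp))) (mem_Q (by simp)), hb₃⟩
    · exact ⟨_, mem_Q (by simp), hb₀⟩
    · exact ⟨_, mem_Q (by simp), hb₂⟩
    · exact ⟨s, mem_Q (by simp), (hzc _).eq.symm⟩
  have := finite_of_card c_bQ (by simp)
  have Q_le_bQ : closure {q₁, q₃, q₀, q₂, z} ≤ closure {b, q₁, q₃, q₀, q₂, z} :=
    closure_mono (Set.subset_insert _ _)
  have a_notMem_bQ : a ∉ closure {b, q₁, q₃, q₀, q₂, z} := fun h => by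
    have hle : closure {a, q₁, q₃, q₀, q₂, z} ≤ closure {b, q₁, q₃, q₀, q₂, z} := by
      rw [closure_le, Set.insert_subset_iff]
      exact ⟨h, subset_closure.trans Q_le_bQ⟩
    have := card_dvd_of_le hle
    rw [c_aQ, c_bQ] at this
    norm_num at this
  have c_G : Nat.card (closure {a, b, q₁, q₃, q₀, q₂, z}) = 320 := by
    rw [card_closure_insert (p := 2) _ _ a_notMem_bQ, c_bQ]
    · rintro s (rfl | hs)
      · exact ⟨_, mul_mem (mul_mem (self (by simp)) (inv_mem (self (by simp))))
          (self (by simp)), hab'⟩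
      · obtain ⟨w, hw, e⟩ := a_conj s hs
        exact ⟨w, Q_le_bQ hw, e⟩
    · rw [pow_two, ha]
      exact self (by simp)
  suffices closure {a, b} = closure {a, b, q₁, q₃, q₀, q₂, z} by rw [this, c_G]
  refine le_antisymm (closure_mono (by simp [Set.insert_subset_iff])) ((closure_le _).2 ?_)
  have ma : a ∈ closure {a, b} := self (by simp)
  have mb : b ∈ closure {a, b} := self (by simp)
  have m₀ : q₀ ∈ closure {a, b} := ha ▸ mul_mem ma ma
  have conj {x y : G} (h : b * x = y * b) (hx : x ∈ closure {a, b}) : y ∈ closure {a, b} := by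
    rw [eq_mul_inv_of_mul_eq h.symm]
    exact mul_mem (mul_mem mb hx) (inv_mem mb)
  have m₁ := conj hb₀ m₀
  have m₂ := conj hb₁ m₁
  have m₃ := conj hb₂ m₂
  have mz : z ∈ closure {a, b} := h₀ ▸ mul_mem m₀ m₀
  simp [Set.insert_subset_iff, ma, mb, m₀, m₁, m₂, m₃, mz]

end Subgroup

namespace OmegaZero

open Zsqrtd

/-- The `8 × 8` matrices over the Gaussian integers. -/
abbrev Mat8 := Matrix (Fin 8) (Fin 8) (Zsqrtd (-1))

/-- The matrix `U₀² C₀`. -/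
def a : Mat8 :=
  !![0, 0, 1, 0, 0, 0, 0, 0;
    -sqrtd, 0, 0, 1, -1, 0, 0, sqrtd;
    0, 0, 0, 0, 0, 0, 0, 1;
    1, -1, 0, 0, 0, 0, 0, 1;
    2, -2, 0, 0, -2 * sqrtd, 2 * sqrtd, -1, 1;
    1, -2, 0, 0, -2 * sqrtd, 2 * sqrtd, -1, 1;
    0, 0, 0, 0, 0, 1, 0, 0;
    0, 0, 0, 0, -1, 1, 0, 0]

/-- The matrix `(a U₀ a)⁻¹ U₀`. -/
def b : Mat8 :=
  !![1, -1, sqrtd, -sqrtd, 0, 0, -1, 1;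
    1, 0, 0, 0, 0, 0, 0, 0;
    0, 0, 0, 1, 0, 0, 0, 0;
    0, -sqrtd, -1, 2, 0, -1, 0, 2 * sqrtd;
    0, 0, 1, 0, 0, -1, sqrtd, sqrtd;
    0, 0, 1, -1, 1, -1, 0, 0;
    -1, 1, 0, -sqrtd, 2 * sqrtd, -sqrtd, 1, 1;
    0, 1, -sqrtd, sqrtd, 0, 0, 0, -1]

/-- The square of `b`. -/
def bSq : Mat8 :=
  !![1, -2, sqrtd, 0, -2 * sqrtd, 2 * sqrtd, -2, 1;
    1, -1, sqrtd, -sqrtd, 0, 0, -1, 1;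
    0, -sqrtd, -1, 2, 0, -1, 0, 2 * sqrtd;
    -sqrtd, 0, -1, 2, -1, -1, 0, 2 * sqrtd;
    -sqrtd, 2 * sqrtd, 0, 2, -3, 2, sqrtd, 0;
    0, sqrtd, 1, 0, -1, 1, sqrtd, -sqrtd;
    -1, 2, 0, 0, sqrtd, -sqrtd, 0, -1;
    1, 0, 0, 0, 0, -sqrtd, 0, -1]

/-- The square of `a`. -/
def q0 : Mat8 :=
  !![0, 0, 0, 0, 0, 0, 0, 1;
    -1, 1, -sqrtd, 0, sqrtd, -sqrtd, 1, 0;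
    0, 0, 0, 0, -1, 1, 0, 0;
    sqrtd, 0, 1, -1, 0, 1, 0, -sqrtd;
    0, 0, 2, -2, 1, 0, 0, -2 * sqrtd;
    0, 0, 1, -2, 1, 0, 0, -2 * sqrtd;
    1, -2, 0, 0, -2 * sqrtd, 2 * sqrtd, -1, 1;
    -1, 0, 0, 0, 0, 0, 0, 0]

/-- The conjugate `b q0 b⁻¹`. -/
def q1 : Mat8 :=
  !![-1, 2, 0, 0, 2 * sqrtd, -2 * sqrtd, 1, -1;
    0, 1, 0, 0, sqrtd, -2 * sqrtd, 1, -1;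
    sqrtd, 0, 1, -2, 1, 0, 0, -sqrtd;
    sqrtd, 0, 1, -1, 0, 1, 0, -sqrtd;
    2 * sqrtd, -2 * sqrtd, 0, 0, 1, 0, 0, 0;
    sqrtd, -2 * sqrtd, 0, 0, 1, -1, 0, sqrtd;
    0, 0, 0, 0, 0, 0, 0, -1;
    0, 0, 0, 0, 0, 0, 1, 0]

/-- The conjugate `b q1 b⁻¹`. -/
def q2 : Mat8 :=
  !![0, 0, 0, 0, 0, 0, 1, 0;
    -1, 1, 0, 0, sqrtd, 0, 1, 0;
    sqrtd, 0, 1, -2, 1, 0, 0, -sqrtd;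
    0, 0, 1, -1, 1, -1, 0, 0;
    -2 * sqrtd, 2 * sqrtd, 0, 0, -1, 0, 0, 0;
    -sqrtd, 2 * sqrtd, 0, 0, -1, 1, 0, -sqrtd;
    -1, 0, 0, 0, 0, 0, 0, 0;
    -1, 2, 0, 0, 2 * sqrtd, -2 * sqrtd, 1, -1]

/-- The conjugate `b q2 b⁻¹`. -/
def q3 : Mat8 :=
  !![-1, 2, -sqrtd, 0, sqrtd, -sqrtd, 1, -1;
    -1, 1, 0, 0, 0, 0, 0, -1;
    0, 0, 0, 0, 0, 1, 0, 0;
    0, 0, 1, -1, 0, 1, sqrtd, -sqrtd;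
    0, 0, 0, -2, 1, 0, 0, -2 * sqrtd;
    0, 0, -1, 0, 0, 0, 0, 0;
    0, 0, -sqrtd, 2 * sqrtd, -sqrtd, sqrtd, 0, -1;
    0, 0, sqrtd, 0, -sqrtd, sqrtd, -1, 0]

theorem b_mul_b : b * b = bSq := by decide +kernel

/-- The matrix `a` as an invertible matrix. -/
def unitA : GL (Fin 8) (Zsqrtd (-1)) where
  val := a
  inv := -(a * q0)
  val_inv := by decide +kernel
  inv_val := by decide +kernel

/-- The matrix `b` as an invertible matrix. -/
def unitB : GL (Fin 8) (Zsqrtd (-1)) where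
  val := b
  inv := -(bSq * bSq)
  val_inv := by decide +kernel
  inv_val := by decide +kernel

/-- A matrix of square `-1` as an invertible matrix. -/
def unitOfSq (q : Mat8) (h : q * q = -1) : GL (Fin 8) (Zsqrtd (-1)) where
  val := q
  inv := -q
  val_inv := by rw [mul_neg, h, neg_neg]
  inv_val := by rw [neg_mul, h, neg_neg]

theorem q0_sq : q0 * q0 = -1 := by decide +kernel
theorem q1_sq : q1 * q1 = -1 := by decide +kernel
theorem q2_sq : q2 * q2 = -1 := by decide +kernel
theorem q3_sq : q3 * q3 = -1 := by decide +kernel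

theorem card_closure_units : Nat.card (Subgroup.closure {unitA, unitB}) = 320 := by
  refine Subgroup.card_closure_pair_eq_320 (z := -1) (q₀ := unitOfSq q0 q0_sq)
    (q₁ := unitOfSq q1 q1_sq) (q₂ := unitOfSq q2 q2_sq) (q₃ := unitOfSq q3 q3_sq)
    (fun h => ?_) (by simp) Commute.neg_one_left
    (Units.ext q0_sq) (Units.ext q1_sq) (Units.ext q2_sq) (Units.ext q3_sq)
    ?_ ?_ ?_ ?_ ?_ ?_ ?_ ?_ ?_ ?_ ?_ ?_ ?_ ?_ ?_ ?_
  · exact absurd (congrArg Units.val h) (show (-1 : Mat8) ≠ 1 by decide +kernel)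
  · exact Units.ext (show q0 * q1 = q1 * q0 by decide +kernel)
  · exact Units.ext (show q1 * q2 = q2 * q1 by decide +kernel)
  · exact Units.ext (show q2 * q3 = q3 * q2 by decide +kernel)
  · exact Units.ext (show q0 * q2 = -1 * q2 * q0 by decide +kernel)
  · exact Units.ext (show q3 * q0 = -1 * q0 * q3 by decide +kernel)
  · exact Units.ext (show q1 * q3 = -1 * q3 * q1 by decide +kernel)
  · exact Units.ext (show b * q0 = q1 * b by decide +kernel)
  · exact Units.ext (show b * q1 = q2 * b by decide +kernel)
  · exact Units.ext (show b * q2 = q3 * b by decide +kernel)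
  · exact Units.ext (show b * q3 = -1 * q0 * q1 * q2 * q3 * b by decide +kernel)
  · have h : bSq * bSq * b = -1 := by decide +kernel
    refine Units.ext ?_
    change b ^ 5 = -1
    rw [← h, ← b_mul_b]
    noncomm_ring
  · exact Units.ext (show a * a = q0 by decide +kernel)
  · exact Units.ext (show a * q1 = q0 * q1 * q2 * q3 * a by decide +kernel)
  · exact Units.ext (show a * q2 = -1 * q3 * a by decide +kernel)
  · exact Units.ext (show a * q3 = q2 * a by decide +kernel)
  · exact Units.ext (show a * b * (a * b) = -1 * q2 by decide +kernel)

end OmegaZero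

/-- For the explicit 8×8 matrices `U₀`, `C₀` over the Gaussian integers
(the specialization `t = 0`, `√(t²−1) = i` of `ω_t`), with `a₀ = U₀²·C₀` and
`b₀ = (a₀·U₀·a₀)⁻¹·U₀`, the matrices `a₀` and `b₀` are invertible over `ℤ[i]` and the
subgroup of `GL(8, ℤ[i])` they generate is finite of order exactly `320`; hence the kernel
`Π = Ker(ω₀)` has index `320` in vol3. -/
theorem omega_zero_image_has_order_320
    (U₀ C₀ : Matrix (Fin 8) (Fin 8) (Zsqrtd (-1)))
    (hU₀ : U₀ = !![1, 0, 0, 0, 0, 0, 0, 0;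
                   0, 1, 0, -Zsqrtd.sqrtd, Zsqrtd.sqrtd, -Zsqrtd.sqrtd, 1, 0;
                   0, 0, 1, -1, 1, -1, 0, 0;
                   0, 0, 1, 0, 0, 0, 0, 0;
                   0, 0, 1, 0, 0, 1, Zsqrtd.sqrtd, -Zsqrtd.sqrtd;
                   0, 0, 1, -1, 0, 1, Zsqrtd.sqrtd, -Zsqrtd.sqrtd;
                   0, 0, 0, 0, 0, 0, 0, -1;
                   0, 0, 0, 0, 0, 0, 1, 0])
    (hC₀ : C₀ = !![0, 0, 1, 0, 0, 0, 0, 0;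
                   0, 0, 0, 1, 0, 0, 0, 0;
                   1, 0, 0, 0, 0, 0, 0, 0;
                   0, 1, 0, 0, 0, 0, 0, 0;
                   0, 0, 0, 0, 0, 0, -1, 1;
                   0, 0, 0, 0, 0, 0, -1, 0;
                   0, 0, 0, 0, 0, -1, 0, 0;
                   0, 0, 0, 0, 1, -1, 0, 0])
    (a₀ b₀ : Matrix (Fin 8) (Fin 8) (Zsqrtd (-1)))
    (ha₀ : a₀ = U₀ ^ 2 * C₀) (hb₀ : b₀ = (a₀ * U₀ * a₀)⁻¹ * U₀) :
    IsUnit a₀ ∧ IsUnit b₀ ∧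
    ∃ A B : GL (Fin 8) (Zsqrtd (-1)), (A : Matrix (Fin 8) (Fin 8) (Zsqrtd (-1))) = a₀ ∧
      (B : Matrix (Fin 8) (Fin 8) (Zsqrtd (-1))) = b₀ ∧
      Nat.card (Subgroup.closure ({A, B} : Set (GL (Fin 8) (Zsqrtd (-1))))) = 320 := by
  have ha : a₀ = OmegaZero.a := by
    rw [ha₀, hU₀, hC₀, pow_two]
    decide +kernel
  have hU : U₀ ^ 2 * U₀ ^ 2 = 1 := by
    rw [hU₀, pow_two]
    decide +kernel
  have hM : a₀ * U₀ * a₀ * OmegaZero.b = U₀ := by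
    rw [ha, hU₀]
    decide +kernel
  have hdet : IsUnit (a₀ * U₀ * a₀).det := by
    refine Matrix.isUnit_det_of_right_inverse (B := OmegaZero.b * U₀ ^ 3) ?_
    rw [← mul_assoc, hM, ← pow_succ', pow_add U₀ 2 2, hU]
  have hb : b₀ = OmegaZero.b := by
    have h := Matrix.nonsing_inv_mul_cancel_left _ OmegaZero.b hdet
    rwa [hM, ← hb₀] at h
  rw [ha, hb]
  exact ⟨OmegaZero.unitA.isUnit, OmegaZero.unitB.isUnit, OmegaZero.unitA, OmegaZero.unitB,
    rfl, rfl, OmegaZero.card_closure_units⟩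
end

section
/- Let m ≥ 2 and let γ be an m×m complex matrix which is diagonalizable (semisimple) with det γ = 1. If trace(γ^q) = m for every integer q with 1 ≤ |q| ≤ m/2, then γ is the identity matrix. Equivalently: if γ is semisimple, det γ = 1, and γ ≠ I, then there exists an integer q with 1 ≤ |q| ≤ m/2 such that trace(γ^q) ≠ m. -/
open Matrix

/-- In characteristic zero, the first `n` power sums determine the first `n` elementary symmetric
polynomials. -/
lemma MvPolynomial.aeval_esymm_eq_of_aeval_psum_eq {σ K : Type*} [Fintype σ] [Field K] [CharZero K]
    (x y : σ → K) (n : ℕ)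
    (h : ∀ k, 1 ≤ k → k ≤ n →
      MvPolynomial.aeval x (MvPolynomial.psum σ K k) =
        MvPolynomial.aeval y (MvPolynomial.psum σ K k))
    (k : ℕ) (hk : k ≤ n) :
    MvPolynomial.aeval x (MvPolynomial.esymm σ K k) =
      MvPolynomial.aeval y (MvPolynomial.esymm σ K k) := by
  induction k using Nat.strong_induction_on with
  | _ k ih =>
    rcases Nat.eq_zero_or_pos k with rfl | hpos
    · simp
    have hx := congrArg (MvPolynomial.aeval x) (MvPolynomial.mul_esymm_eq_sum σ K k)
    have hy := congrArg (MvPolynomial.aeval y) (MvPolynomial.mul_esymm_eq_sum σ K k)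
    simp only [map_mul, map_sum, map_pow, map_neg, map_one, map_natCast] at hx hy
    refine mul_left_cancel₀ (Nat.cast_ne_zero.mpr hpos.ne' : (k : K) ≠ 0) ?_
    rw [hx, hy]
    congr 1
    refine Finset.sum_congr rfl fun a ha => ?_
    rw [Finset.mem_filter, Finset.HasAntidiagonal.mem_antidiagonal] at ha
    rw [ih a.1 ha.2 (by omega), h a.2 (by omega) (by omega)]

/-- If the product of the `x i` is `1`, inverting the `x i` reverses the elementary symmetric
functions. -/
lemma MvPolynomial.aeval_esymm_eq_aeval_inv_esymm {σ K : Type*} [Fintype σ] [Field K]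
    (x : σ → K) (hx : ∏ i, x i = 1) (k : ℕ) (hk : k ≤ Fintype.card σ) :
    MvPolynomial.aeval x (MvPolynomial.esymm σ K k) =
      MvPolynomial.aeval x⁻¹ (MvPolynomial.esymm σ K (Fintype.card σ - k)) := by
  classical
  simp only [MvPolynomial.esymm, map_sum, map_prod, MvPolynomial.aeval_X]
  refine Finset.sum_nbij' compl compl ?_ ?_ ?_ ?_ ?_
  · intro s hs
    simp only [Finset.mem_powersetCard_univ, Finset.card_compl] at hs ⊢
    omega
  · intro s hs
    simp only [Finset.mem_powersetCard_univ, Finset.card_compl] at hs ⊢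
    omega
  · simp
  · simp
  · intro s _
    simp only [Pi.inv_apply, Finset.prod_inv_distrib]
    exact eq_inv_of_mul_eq_one_left (by rw [Finset.prod_mul_prod_compl, hx])

/-- A family whose elementary symmetric functions are those of the constant family `1` is
constantly `1`. -/
lemma MvPolynomial.eq_one_of_aeval_esymm_eq {σ K : Type*} [Fintype σ] [Field K] (x : σ → K)
    (h : ∀ k ≤ Fintype.card σ, MvPolynomial.aeval x (MvPolynomial.esymm σ K k) =
      MvPolynomial.aeval (1 : σ → K) (MvPolynomial.esymm σ K k)) :
    x = 1 := by
  have key : ((Finset.univ.val.map x).map fun t => Polynomial.X - Polynomial.C t).prod =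
      ((Finset.univ.val.map (1 : σ → K)).map fun t => Polynomial.X - Polynomial.C t).prod := by
    simp only [Multiset.prod_X_sub_X_eq_sum_esymm, ← MvPolynomial.aeval_esymm_eq_multiset_esymm σ K,
      Multiset.card_map]
    refine Finset.sum_congr rfl fun k hk => ?_
    rw [h k (by simpa [Nat.lt_succ_iff] using hk)]
  ext i
  have hi := congrArg (Polynomial.eval (x i)) key
  simp only [Multiset.map_map, Finset.prod_map_val, Polynomial.eval_prod, Function.comp_apply,
    Polynomial.eval_sub, Polynomial.eval_X, Polynomial.eval_C] at hi
  rw [Finset.prod_eq_zero (Finset.mem_univ i) (sub_self _)] at hi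
  obtain ⟨j, -, hj⟩ := Finset.prod_eq_zero_iff.mp hi.symm
  exact sub_eq_zero.mp hj

lemma Matrix.trace_pow_eq_of_semiconjBy_diagonal {n K : Type*} [Fintype n] [DecidableEq n]
    [Field K] {P A : Matrix n n K} {d : n → K} (hP : IsUnit P)
    (h : SemiconjBy P (Matrix.diagonal d) A) (k : ℕ) :
    (A ^ k).trace = ∑ i, d i ^ k := by
  have hdet : IsUnit P.det := (Matrix.isUnit_iff_isUnit_det P).mp hP
  have hk : A ^ k = P * Matrix.diagonal d ^ k * P⁻¹ := by
    rw [(h.pow_right k).eq, Matrix.mul_assoc, Matrix.mul_nonsing_inv _ hdet, Matrix.mul_one]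
  rw [hk, Matrix.trace_mul_comm, ← Matrix.mul_assoc, Matrix.nonsing_inv_mul _ hdet, Matrix.one_mul,
    Matrix.diagonal_pow, Matrix.trace_diagonal]
  rfl

/-- Let `m ≥ 2` and `γ` an `m×m` complex matrix which is diagonalizable
(semisimple) with `det γ = 1`. If `trace(γ^q) = m` for every integer `q` with
`1 ≤ |q| ≤ m/2` (i.e. `2|q| ≤ m`), then `γ = 1`. -/
theorem semisimple_with_all_traces_m_is_identity (m : ℕ) (hm : 2 ≤ m)
    (γ : Matrix (Fin m) (Fin m) ℂ)
    (hss : ∃ P : Matrix (Fin m) (Fin m) ℂ, IsUnit P ∧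
      ∃ D : Fin m → ℂ, P⁻¹ * γ * P = Matrix.diagonal D)
    (hdet : γ.det = 1)
    (htr : ∀ q : ℤ, 1 ≤ |q| → 2 * |q| ≤ (m : ℤ) → (γ ^ q).trace = (m : ℂ)) :
    γ = 1 := by
  obtain ⟨P, hP, D, hD⟩ := hss
  have hPdet : IsUnit P.det := (Matrix.isUnit_iff_isUnit_det P).mp hP
  have hγdet : IsUnit γ.det := by simp [hdet]
  have hprod : ∏ i, D i = 1 := by
    rw [← Matrix.det_diagonal, ← hD, Matrix.det_conj' hP, hdet]
  have hD0 : ∀ i, D i ≠ 0 := fun i =>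
    Finset.prod_ne_zero_iff.mp (hprod ▸ one_ne_zero) i (Finset.mem_univ i)
  have hsemi : SemiconjBy P (Matrix.diagonal D) γ := by
    rw [SemiconjBy, ← hD, Matrix.mul_assoc, Matrix.mul_nonsing_inv_cancel_left _ _ hPdet]
  have hsemi' : SemiconjBy P (Matrix.diagonal D⁻¹) γ⁻¹ := by
    have hDD : Matrix.diagonal D * Matrix.diagonal D⁻¹ = 1 := by
      rw [Matrix.diagonal_mul_diagonal, ← Matrix.diagonal_one]
      exact congrArg _ (funext fun i => mul_inv_cancel₀ (hD0 i))
    calc P * Matrix.diagonal D⁻¹ = γ⁻¹ * (γ * P) * Matrix.diagonal D⁻¹ := by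
          rw [Matrix.nonsing_inv_mul_cancel_left _ _ hγdet]
      _ = γ⁻¹ * P := by
          rw [← hsemi.eq, Matrix.mul_assoc, Matrix.mul_assoc, hDD, Matrix.mul_one]
  have hpos : ∀ k, k ≤ m / 2 →
      MvPolynomial.aeval D (MvPolynomial.esymm (Fin m) ℂ k) =
        MvPolynomial.aeval (1 : Fin m → ℂ) (MvPolynomial.esymm (Fin m) ℂ k) := by
    refine MvPolynomial.aeval_esymm_eq_of_aeval_psum_eq _ _ _ fun k hk1 hk2 => ?_
    have := htr k (by simp; omega) (by simp; omega)
    rw [zpow_natCast, Matrix.trace_pow_eq_of_semiconjBy_diagonal hP hsemi] at this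
    simpa [MvPolynomial.psum] using this
  have hneg : ∀ k, k ≤ m / 2 →
      MvPolynomial.aeval D⁻¹ (MvPolynomial.esymm (Fin m) ℂ k) =
        MvPolynomial.aeval (1 : Fin m → ℂ) (MvPolynomial.esymm (Fin m) ℂ k) := by
    refine MvPolynomial.aeval_esymm_eq_of_aeval_psum_eq _ _ _ fun k hk1 hk2 => ?_
    have := htr (-k) (by simp; omega) (by simp; omega)
    rw [Matrix.zpow_neg_natCast, ← Matrix.inv_pow',
      Matrix.trace_pow_eq_of_semiconjBy_diagonal hP hsemi'] at this
    simpa [MvPolynomial.psum] using this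
  have hD1 : D = 1 := by
    refine MvPolynomial.eq_one_of_aeval_esymm_eq D fun k hk => ?_
    by_cases hkm : k ≤ m / 2
    · exact hpos k hkm
    · rw [MvPolynomial.aeval_esymm_eq_aeval_inv_esymm D hprod k hk,
        MvPolynomial.aeval_esymm_eq_aeval_inv_esymm 1 (by simp) k hk, inv_one]
      exact hneg _ (by rw [Fintype.card_fin] at hk ⊢; omega)
  have hγP : γ * P = P := by
    rw [← hsemi.eq, hD1, Pi.one_def, Matrix.diagonal_one, Matrix.mul_one]
  exact hP.mul_right_cancel (by rw [hγP, Matrix.one_mul])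
end
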